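/- Let x be an ADHM datum for ℙ¹ over k = ℂ with underlying spaces V, W. Then the orbit GL(V)·x is a closed subset of B̃ (standard topology) if and only if there exists a direct sum decomposition V = V₁ ⊕ V₂ such that: B_{k,l}(V₁) ⊆ V₁ and B_{k,l}(V₂) ⊆ V₂ for all k ∈ {1,2}, l ∈ {0,1}; im i₀ ⊆ V₁ and im i₁ ⊆ V₁; V₂ ⊆ ker j₀ ∩ ker j₁; the induced ADHM datum x₁ = (B_{k,l}|_{V₁}, i_l, j_l|_{V₁}) on (W, V₁) is stable and costable; and the induced ADHM datum x₂ = (B_{k,l}|_{V₂}, 0, 0) on ({0}, V₂) has closed GL(V₂)-orbit. Moreover, such a decomposition V = V₁ ⊕ V₂ (and hence the splitting x = x₁ ⊕ x₂) is unique. -/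

import Mathlib

open Matrix

/-- The space `B̃` of ADHM tuples for `ℙ¹` (with `V = ℂⁿ`, `W = ℂᵐ`). -/
abbrev ADHMSpace (n m : ℕ) :=
  (Fin 2 → Fin 2 → Matrix (Fin n) (Fin n) ℂ) ×
  (Fin 2 → Matrix (Fin n) (Fin m) ℂ) ×
  (Fin 2 → Matrix (Fin m) (Fin n) ℂ)

/-- The ADHM equations. -/
def ADHMEq {n m : ℕ} (x : ADHMSpace n m) : Prop :=
  x.1 0 0 * x.1 1 0 - x.1 1 0 * x.1 0 0 + x.2.1 0 * x.2.2 0 = 0 ∧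
  x.1 0 0 * x.1 1 1 - x.1 1 1 * x.1 0 0 + x.1 0 1 * x.1 1 0 - x.1 1 0 * x.1 0 1
      + x.2.1 0 * x.2.2 1 + x.2.1 1 * x.2.2 0 = 0 ∧
  x.1 0 1 * x.1 1 1 - x.1 1 1 * x.1 0 1 + x.2.1 1 * x.2.2 1 = 0

/-- The action of `g ∈ GL(V)` on `B̃`. -/
noncomputable def ADHMAct {n m : ℕ} (g : (Matrix (Fin n) (Fin n) ℂ)ˣ)
    (x : ADHMSpace n m) : ADHMSpace n m :=
  (fun k l => (g : Matrix (Fin n) (Fin n) ℂ) * x.1 k l *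
      ((g⁻¹ : (Matrix (Fin n) (Fin n) ℂ)ˣ) : Matrix (Fin n) (Fin n) ℂ),
   fun l => (g : Matrix (Fin n) (Fin n) ℂ) * x.2.1 l,
   fun l => x.2.2 l * ((g⁻¹ : (Matrix (Fin n) (Fin n) ℂ)ˣ) : Matrix (Fin n) (Fin n) ℂ))

/-- A decomposition `V = V₁ ⊕ V₂` as in Lemma `polystable`: both summands are invariant
under all `B`-components, the images of the `i`-components lie in `V₁`,
`V₂ ⊆ ker j₀ ∩ ker j₁`, the induced datum `x₁` on `(W, V₁)` is stable and costable,
and the induced datum `x₂ = (B|_{V₂}, 0, 0)` on `({0}, V₂)` has closed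
`GL(V₂)`-orbit (expressed through matrices via an isomorphism `V₂ ≃ ℂᵖ`). -/
def ADHMGoodDecomp {n m : ℕ} (x : ADHMSpace n m)
    (V₁ V₂ : Submodule ℂ (Fin n → ℂ)) : Prop :=
  IsCompl V₁ V₂ ∧
  (∀ k l : Fin 2, V₁.map (Matrix.toLin' (x.1 k l)) ≤ V₁) ∧
  (∀ k l : Fin 2, V₂.map (Matrix.toLin' (x.1 k l)) ≤ V₂) ∧
  (LinearMap.range (Matrix.toLin' (x.2.1 0)) ≤ V₁ ∧
   LinearMap.range (Matrix.toLin' (x.2.1 1)) ≤ V₁) ∧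
  (V₂ ≤ LinearMap.ker (Matrix.toLin' (x.2.2 0)) ⊓
        LinearMap.ker (Matrix.toLin' (x.2.2 1))) ∧
  -- the induced datum on `(W, V₁)` is stable
  (∀ S : Submodule ℂ (Fin n → ℂ), S < V₁ →
    (∀ k l : Fin 2, S.map (Matrix.toLin' (x.1 k l)) ≤ S) →
    ¬(LinearMap.range (Matrix.toLin' (x.2.1 0)) ≤ S ∧
      LinearMap.range (Matrix.toLin' (x.2.1 1)) ≤ S)) ∧
  -- the induced datum on `(W, V₁)` is costable
  (∀ S : Submodule ℂ (Fin n → ℂ), S ≤ V₁ → S ≠ ⊥ →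
    (∀ k l : Fin 2, S.map (Matrix.toLin' (x.1 k l)) ≤ S) →
    ¬(S ≤ LinearMap.ker (Matrix.toLin' (x.2.2 0)) ⊓
          LinearMap.ker (Matrix.toLin' (x.2.2 1)))) ∧
  -- the induced datum `x₂ = (B|_{V₂}, 0, 0)` has closed `GL(V₂)`-orbit
  (∃ (p : ℕ) (e : V₂ ≃ₗ[ℂ] (Fin p → ℂ)) (M : Fin 2 → Fin 2 → Matrix (Fin p) (Fin p) ℂ),
    (∀ (k l : Fin 2) (w : Fin p → ℂ),
      ((e.symm (M k l *ᵥ w) : Fin n → ℂ)) = x.1 k l *ᵥ ((e.symm w : Fin n → ℂ))) ∧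
    IsClosed {C : Fin 2 → Fin 2 → Matrix (Fin p) (Fin p) ℂ |
      ∃ g : (Matrix (Fin p) (Fin p) ℂ)ˣ, ∀ k l : Fin 2,
        C k l = (g : Matrix (Fin p) (Fin p) ℂ) * M k l *
          ((g⁻¹ : (Matrix (Fin p) (Fin p) ℂ)ˣ) : Matrix (Fin p) (Fin p) ℂ)})

namespace ADHM

variable {n m p : ℕ}

/-- `U` is invariant under all `B`-components of `x`. -/
def BInvariant (x : ADHMSpace n m) (U : Submodule ℂ (Fin n → ℂ)) : Prop :=
  ∀ k l, ∀ v ∈ U, x.1 k l *ᵥ v ∈ U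

/-- `U` contains the images of all `i`-components of `x`. -/
def ContainsImages (x : ADHMSpace n m) (U : Submodule ℂ (Fin n → ℂ)) : Prop :=
  ∀ l w, x.2.1 l *ᵥ w ∈ U

/-- `U` lies in the kernels of all `j`-components of `x`. -/
def InKernels (x : ADHMSpace n m) (U : Submodule ℂ (Fin n → ℂ)) : Prop :=
  ∀ l, ∀ v ∈ U, x.2.2 l *ᵥ v = 0

lemma bInvariant_iff (x : ADHMSpace n m) (U : Submodule ℂ (Fin n → ℂ)) :
    (∀ k l : Fin 2, U.map (Matrix.toLin' (x.1 k l)) ≤ U) ↔ BInvariant x U := by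
  simp only [Submodule.map_le_iff_le_comap]
  exact Iff.rfl

lemma containsImages_iff (x : ADHMSpace n m) (U : Submodule ℂ (Fin n → ℂ)) :
    (LinearMap.range (Matrix.toLin' (x.2.1 0)) ≤ U ∧
      LinearMap.range (Matrix.toLin' (x.2.1 1)) ≤ U) ↔ ContainsImages x U := by
  simp only [ContainsImages, Fin.forall_fin_two, LinearMap.range_le_iff_comap,
    Submodule.eq_top_iff', Submodule.mem_comap, Matrix.toLin'_apply]

lemma inKernels_iff (x : ADHMSpace n m) (U : Submodule ℂ (Fin n → ℂ)) :
    (U ≤ LinearMap.ker (Matrix.toLin' (x.2.2 0)) ⊓ LinearMap.ker (Matrix.toLin' (x.2.2 1))) ↔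
      InKernels x U := by
  simp only [InKernels, Fin.forall_fin_two, le_inf_iff]
  exact Iff.rfl

lemma BInvariant.inf {x : ADHMSpace n m} {U U' : Submodule ℂ (Fin n → ℂ)}
    (h : BInvariant x U) (h' : BInvariant x U') : BInvariant x (U ⊓ U') :=
  fun k l v hv => ⟨h k l v hv.1, h' k l v hv.2⟩

lemma BInvariant.sup {x : ADHMSpace n m} {U U' : Submodule ℂ (Fin n → ℂ)}
    (h : BInvariant x U) (h' : BInvariant x U') : BInvariant x (U ⊔ U') := by
  intro k l v hv
  obtain ⟨a, ha, b, hb, rfl⟩ := Submodule.mem_sup.1 hv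
  rw [Matrix.mulVec_add]
  exact Submodule.add_mem_sup (h k l a ha) (h' k l b hb)

lemma InKernels.sup {x : ADHMSpace n m} {U U' : Submodule ℂ (Fin n → ℂ)}
    (h : InKernels x U) (h' : InKernels x U') : InKernels x (U ⊔ U') := by
  intro l v hv
  obtain ⟨a, ha, b, hb, rfl⟩ := Submodule.mem_sup.1 hv
  rw [Matrix.mulVec_add, h l a ha, h' l b hb, add_zero]

/-- The smallest `B`-invariant subspace containing the images of the `i`-components. -/
def stableCore (x : ADHMSpace n m) : Submodule ℂ (Fin n → ℂ) :=
  sInf {U | BInvariant x U ∧ ContainsImages x U}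

/-- The largest `B`-invariant subspace contained in the kernels of the `j`-components. -/
def costableCore (x : ADHMSpace n m) : Submodule ℂ (Fin n → ℂ) :=
  sSup {U | BInvariant x U ∧ InKernels x U}

lemma stableCore_le {x : ADHMSpace n m} {U : Submodule ℂ (Fin n → ℂ)}
    (h : BInvariant x U) (h' : ContainsImages x U) : stableCore x ≤ U :=
  sInf_le ⟨h, h'⟩

lemma le_costableCore {x : ADHMSpace n m} {U : Submodule ℂ (Fin n → ℂ)}
    (h : BInvariant x U) (h' : InKernels x U) : U ≤ costableCore x :=
  le_sSup ⟨h, h'⟩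

lemma bInvariant_stableCore (x : ADHMSpace n m) : BInvariant x (stableCore x) := by
  intro k l v hv
  simp only [stableCore, Submodule.mem_sInf] at hv ⊢
  exact fun U hU => hU.1 k l v (hv U hU)

lemma containsImages_stableCore (x : ADHMSpace n m) : ContainsImages x (stableCore x) := by
  intro l w
  simp only [stableCore, Submodule.mem_sInf]
  exact fun U hU => hU.2 l w

lemma bInvariant_costableCore (x : ADHMSpace n m) : BInvariant x (costableCore x) := by
  refine (bInvariant_iff x _).1 fun k l => ?_
  rw [Submodule.map_le_iff_le_comap]
  refine sSup_le fun U hU v hv => ?_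
  exact le_costableCore hU.1 hU.2 (hU.1 k l v hv)

lemma inKernels_costableCore (x : ADHMSpace n m) : InKernels x (costableCore x) :=
  (inKernels_iff x _).1 (sSup_le fun U hU => (inKernels_iff x U).2 hU.2)

lemma goodDecomp_eq_cores {x : ADHMSpace n m} {V₁ V₂ : Submodule ℂ (Fin n → ℂ)}
    (h : ADHMGoodDecomp x V₁ V₂) : V₁ = stableCore x ∧ V₂ = costableCore x := by
  obtain ⟨hc, h₁, h₂, hi, hj, hst, hcost, -⟩ := h
  rw [bInvariant_iff] at h₁ h₂
  rw [containsImages_iff] at hi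
  rw [inKernels_iff] at hj
  constructor
  · refine ((stableCore_le h₁ hi).eq_of_not_lt fun hlt => ?_).symm
    exact hst _ hlt ((bInvariant_iff x _).2 (bInvariant_stableCore x))
      ((containsImages_iff x _).2 (containsImages_stableCore x))
  · have hle : V₂ ≤ costableCore x := le_costableCore h₂ hj
    have hbot : costableCore x ⊓ V₁ = ⊥ := by
      by_contra hne
      refine hcost _ inf_le_right hne
        ((bInvariant_iff x _).2 ((bInvariant_costableCore x).inf h₁))
        ((inKernels_iff x _).2 fun l v hv => inKernels_costableCore x l v hv.1)
    exact eq_of_le_of_inf_le_of_sup_le hle (by rw [hbot]; exact bot_le)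
      (by rw [hc.symm.sup_eq_top]; exact le_top)

lemma matrix_ext_mulVec {a b : ℕ} {A B : Matrix (Fin a) (Fin b) ℂ}
    (h : ∀ v, A *ᵥ v = B *ᵥ v) : A = B :=
  Matrix.toLin'.injective (LinearMap.ext h)

lemma exists_matrix_splitting {U₁ U₂ : Submodule ℂ (Fin n → ℂ)} (h : IsCompl U₁ U₂)
    (φ : U₂ ≃ₗ[ℂ] (Fin p → ℂ)) :
    ∃ (E : Matrix (Fin p) (Fin n) ℂ) (F : Matrix (Fin n) (Fin p) ℂ),
      (∀ w, F *ᵥ w = φ.symm w) ∧ E * F = 1 ∧ (∀ v ∈ U₁, E *ᵥ v = 0) ∧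
      (∀ v ∈ U₂, F *ᵥ (E *ᵥ v) = v) := by
  refine ⟨LinearMap.toMatrix' (φ.toLinearMap ∘ₗ U₂.projectionOnto U₁ h.symm),
    LinearMap.toMatrix' (U₂.subtype ∘ₗ φ.symm.toLinearMap), ?_, ?_, ?_, ?_⟩
  · intro w
    simp [LinearMap.toMatrix'_mulVec]
  · apply matrix_ext_mulVec
    intro v
    rw [← Matrix.mulVec_mulVec]
    simp [LinearMap.toMatrix'_mulVec, Submodule.projectionOnto_apply_left]
  · intro v hv
    simp [LinearMap.toMatrix'_mulVec, Submodule.projectionOnto_apply_eq_zero_iff, hv]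
  · intro v hv
    simp [LinearMap.toMatrix'_mulVec, Submodule.projectionOnto_apply_of_mem_left h.symm hv]

lemma exists_matrix_splitting_of_trace {q : Matrix (Fin n) (Fin n) ℂ} (hq : q * q = q)
    (ht : q.trace = p) :
    ∃ (E : Matrix (Fin p) (Fin n) ℂ) (F : Matrix (Fin n) (Fin p) ℂ),
      E * F = 1 ∧ F * E = q := by
  have hid : IsIdempotentElem (Matrix.toLin' q) := by
    rw [IsIdempotentElem, Module.End.mul_eq_comp, ← Matrix.toLin'_mul, hq]
  have hproj := LinearMap.IsIdempotentElem.isProj_range _ hid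
  have hrank : Module.finrank ℂ (LinearMap.range (Matrix.toLin' q)) = p := by
    have := hproj.trace
    rw [Matrix.trace_toLin'_eq, ht] at this
    exact_mod_cast this.symm
  let φ : LinearMap.range (Matrix.toLin' q) ≃ₗ[ℂ] (Fin p → ℂ) :=
    LinearEquiv.ofFinrankEq _ _ (by simp [hrank])
  obtain ⟨E, F, -, hEF, h₁, h₂⟩ :=
    exists_matrix_splitting (LinearMap.IsIdempotentElem.isCompl hid).symm φ
  refine ⟨E, F, hEF, matrix_ext_mulVec fun v => ?_⟩
  have hv : E *ᵥ v = E *ᵥ (q *ᵥ v) := by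
    rw [← sub_eq_zero, ← Matrix.mulVec_sub]
    refine h₁ _ ?_
    rw [LinearMap.mem_ker, Matrix.toLin'_apply, Matrix.mulVec_sub, Matrix.mulVec_mulVec, hq,
      sub_self]
  rw [← Matrix.mulVec_mulVec, hv]
  exact h₂ _ ⟨v, rfl⟩

/-- There is a matrix of the projection onto `U₁` along `U₂`. -/
lemma exists_projection_matrix {U₁ U₂ : Submodule ℂ (Fin n → ℂ)} (h : IsCompl U₁ U₂) :
    ∃ q : Matrix (Fin n) (Fin n) ℂ, (∀ v, q *ᵥ v ∈ U₁) ∧ (∀ v ∈ U₁, q *ᵥ v = v) ∧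
      (∀ v ∈ U₂, q *ᵥ v = 0) := by
  refine ⟨LinearMap.toMatrix' (U₁.projection U₂ h), ?_, ?_, ?_⟩
  · intro v
    simp [LinearMap.toMatrix'_mulVec]
  · intro v hv
    simp [LinearMap.toMatrix'_mulVec, Submodule.projection_apply_of_mem_left h hv]
  · intro v hv
    simp [LinearMap.toMatrix'_mulVec, hv]

/-- The `GL(V)`-orbit of `x`. -/
abbrev orbit (x : ADHMSpace n m) : Set (ADHMSpace n m) :=
  {y | ∃ g : (Matrix (Fin n) (Fin n) ℂ)ˣ, y = ADHMAct g x}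

lemma mem_orbit_of_punctured {x : ADHMSpace n m} (h : IsClosed (orbit x))
    {c : ℂ → ADHMSpace n m} (hc : Continuous c) (hs : ∀ s ≠ 0, c s ∈ orbit x) :
    c 0 ∈ orbit x := by
  have hsub : closure ({0}ᶜ : Set ℂ) ⊆ c ⁻¹' orbit x :=
    closure_minimal (fun s hs' => hs s hs') (h.preimage hc)
  rw [(dense_compl_singleton (0 : ℂ)).closure_eq] at hsub
  exact hsub (Set.mem_univ 0)

/-- The linear automorphism of `V` given by an invertible matrix. -/
noncomputable def mulVecEquiv (g : (Matrix (Fin n) (Fin n) ℂ)ˣ) : (Fin n → ℂ) ≃ₗ[ℂ] (Fin n → ℂ) :=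
  LinearEquiv.ofLinearMap (Matrix.toLin' (g : Matrix (Fin n) (Fin n) ℂ))
    (Matrix.toLin' ((g⁻¹ : (Matrix (Fin n) (Fin n) ℂ)ˣ) : Matrix (Fin n) (Fin n) ℂ))
    (by rw [← Matrix.toLin'_mul, Units.mul_inv, Matrix.toLin'_one])
    (by rw [← Matrix.toLin'_mul, Units.inv_mul, Matrix.toLin'_one])

lemma mem_map_mulVecEquiv_symm (g : (Matrix (Fin n) (Fin n) ℂ)ˣ)
    (U : Submodule ℂ (Fin n → ℂ)) (v : Fin n → ℂ) :
    v ∈ U.map (mulVecEquiv g).symm.toLinearMap ↔ (g : Matrix (Fin n) (Fin n) ℂ) *ᵥ v ∈ U :=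
  Submodule.mem_map_equiv (e := (mulVecEquiv g).symm) (x := v) U

lemma BInvariant.of_act {g : (Matrix (Fin n) (Fin n) ℂ)ˣ} {x : ADHMSpace n m}
    {U : Submodule ℂ (Fin n → ℂ)} (h : BInvariant (ADHMAct g x) U) :
    BInvariant x (U.map (mulVecEquiv g).symm.toLinearMap) := by
  intro k l v hv
  rw [mem_map_mulVecEquiv_symm] at hv ⊢
  have := h k l _ hv
  rw [Matrix.mulVec_mulVec] at this ⊢
  simpa [ADHMAct, Matrix.mul_assoc] using this

lemma ContainsImages.of_act {g : (Matrix (Fin n) (Fin n) ℂ)ˣ} {x : ADHMSpace n m}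
    {U : Submodule ℂ (Fin n → ℂ)} (h : ContainsImages (ADHMAct g x) U) :
    ContainsImages x (U.map (mulVecEquiv g).symm.toLinearMap) := by
  intro l w
  rw [mem_map_mulVecEquiv_symm, Matrix.mulVec_mulVec]
  exact h l w

lemma InKernels.of_act {g : (Matrix (Fin n) (Fin n) ℂ)ˣ} {x : ADHMSpace n m}
    {U : Submodule ℂ (Fin n → ℂ)} (h : InKernels (ADHMAct g x) U) :
    InKernels x (U.map (mulVecEquiv g).symm.toLinearMap) := by
  intro l v hv
  rw [mem_map_mulVecEquiv_symm] at hv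
  have := h l _ hv
  rw [Matrix.mulVec_mulVec] at this
  simpa [ADHMAct, Matrix.mul_assoc] using this

/-- A `B`-invariant splitting compatible with `i` and `j`. -/
def IsSplitting (x : ADHMSpace n m) (U₁ U₂ : Submodule ℂ (Fin n → ℂ)) : Prop :=
  IsCompl U₁ U₂ ∧ BInvariant x U₁ ∧ BInvariant x U₂ ∧ ContainsImages x U₁ ∧ InKernels x U₂

lemma IsSplitting.of_act {g : (Matrix (Fin n) (Fin n) ℂ)ˣ} {x : ADHMSpace n m}
    {U₁ U₂ : Submodule ℂ (Fin n → ℂ)} (h : IsSplitting (ADHMAct g x) U₁ U₂) :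
    IsSplitting x (U₁.map (mulVecEquiv g).symm.toLinearMap)
      (U₂.map (mulVecEquiv g).symm.toLinearMap) := by
  obtain ⟨hc, h₁, h₂, hi, hj⟩ := h
  exact ⟨(Submodule.orderIsoMapComap (mulVecEquiv g).symm).isCompl_iff.1 hc,
    h₁.of_act, h₂.of_act, hi.of_act, hj.of_act⟩

/-- The scaling by `a` on the image of the idempotent `q` and by `b` on its kernel. -/
noncomputable def idempotentScaling (q : Matrix (Fin n) (Fin n) ℂ) (hq : q * q = q) (a b : ℂ)
    (ha : a ≠ 0) (hb : b ≠ 0) : (Matrix (Fin n) (Fin n) ℂ)ˣ where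
  val := a • q + b • (1 - q)
  inv := a⁻¹ • q + b⁻¹ • (1 - q)
  val_inv := by
    simp [mul_add, add_mul, mul_sub, sub_mul, smul_smul, hq, ha, hb]
  inv_val := by
    simp [mul_add, add_mul, mul_sub, sub_mul, smul_smul, hq, ha, hb]

/-- The block-diagonal part of `B` with respect to the idempotent `q`. -/
def blockDiag (q : Matrix (Fin n) (Fin n) ℂ) (B : Matrix (Fin n) (Fin n) ℂ) :
    Matrix (Fin n) (Fin n) ℂ :=
  q * B * q + (1 - q) * B * (1 - q)

lemma scaling_conj {q B : Matrix (Fin n) (Fin n) ℂ} (hB : (1 - q) * B * q = 0)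
    {a b : ℂ} (ha : a ≠ 0) (hb : b ≠ 0) :
    (a • q + b • (1 - q)) * B * (a⁻¹ • q + b⁻¹ • (1 - q)) =
      blockDiag q B + (a * b⁻¹) • (q * B * (1 - q)) := by
  have h : (a • q + b • (1 - q)) * B * (a⁻¹ • q + b⁻¹ • (1 - q)) =
      (a * a⁻¹) • (q * B * q) + (a * b⁻¹) • (q * B * (1 - q)) +
      (b * a⁻¹) • ((1 - q) * B * q) + (b * b⁻¹) • ((1 - q) * B * (1 - q)) := by
    generalize 1 - q = r
    simp only [mul_add, add_mul, smul_mul_assoc, mul_smul_comm]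
    module
  rw [h, hB, mul_inv_cancel₀ ha, mul_inv_cancel₀ hb, blockDiag]
  simp only [one_smul, smul_zero]
  abel

lemma blockDiag_mulVec_left {q B : Matrix (Fin n) (Fin n) ℂ} {v : Fin n → ℂ}
    (hv : q *ᵥ v = v) : blockDiag q B *ᵥ v = q *ᵥ (B *ᵥ v) := by
  simp [blockDiag, Matrix.add_mulVec, ← Matrix.mulVec_mulVec, Matrix.sub_mulVec, hv]

lemma blockDiag_mulVec_right {q B : Matrix (Fin n) (Fin n) ℂ} {v : Fin n → ℂ}
    (hv : q *ᵥ v = 0) : blockDiag q B *ᵥ v = B *ᵥ v - q *ᵥ (B *ᵥ v) := by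
  simp [blockDiag, Matrix.add_mulVec, ← Matrix.mulVec_mulVec, Matrix.sub_mulVec, hv]

lemma sub_mem_of_projection {U₁ U₂ : Submodule ℂ (Fin n → ℂ)} (h : IsCompl U₁ U₂)
    {q : Matrix (Fin n) (Fin n) ℂ} (hq₁ : ∀ v ∈ U₁, q *ᵥ v = v)
    (hq₂ : ∀ v ∈ U₂, q *ᵥ v = 0) (v : Fin n → ℂ) : v - q *ᵥ v ∈ U₂ := by
  obtain ⟨a, ha, b, hb, rfl⟩ := Submodule.mem_sup.1
    (h.sup_eq_top ▸ Submodule.mem_top : v ∈ U₁ ⊔ U₂)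
  rw [Matrix.mulVec_add, hq₁ a ha, hq₂ b hb]
  simpa using hb

lemma exists_block_projection {x : ADHMSpace n m} {U U' : Submodule ℂ (Fin n → ℂ)}
    (hc : IsCompl U U') (hU : BInvariant x U) :
    ∃ q : Matrix (Fin n) (Fin n) ℂ, q * q = q ∧ (∀ v, q *ᵥ v ∈ U) ∧
      (∀ v, v - q *ᵥ v ∈ U') ∧ (∀ v ∈ U, q *ᵥ v = v) ∧ (∀ v ∈ U', q *ᵥ v = 0) ∧
      (∀ k l, (1 - q) * x.1 k l * q = 0) ∧
      (∀ k l, ∀ v ∈ U, blockDiag q (x.1 k l) *ᵥ v ∈ U) ∧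
      (∀ k l, ∀ v ∈ U', blockDiag q (x.1 k l) *ᵥ v ∈ U') := by
  obtain ⟨q, hqm, hq₁, hq₂⟩ := exists_projection_matrix hc
  have hq' := sub_mem_of_projection hc hq₁ hq₂
  refine ⟨q, matrix_ext_mulVec fun v => ?_, hqm, hq', hq₁, hq₂, fun k l =>
    matrix_ext_mulVec fun v => ?_, fun k l v hv => ?_, fun k l v hv => ?_⟩
  · rw [← Matrix.mulVec_mulVec, hq₁ _ (hqm v)]
  · rw [← Matrix.mulVec_mulVec, ← Matrix.mulVec_mulVec, Matrix.sub_mulVec,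
      hq₁ _ (hU k l _ (hqm v))]
    simp
  · rw [blockDiag_mulVec_left (hq₁ v hv)]
    exact hqm _
  · rw [blockDiag_mulVec_right (hq₂ v hv)]
    exact hq' _

lemma exists_splitting_of_containsImages {x : ADHMSpace n m} (h : IsClosed (orbit x))
    {U : Submodule ℂ (Fin n → ℂ)} (hU : BInvariant x U) (hi : ContainsImages x U) :
    ∃ U₁ U₂, IsSplitting x U₁ U₂ ∧ Module.finrank ℂ U₁ = Module.finrank ℂ U := by
  obtain ⟨U', hc⟩ := U.exists_isCompl
  obtain ⟨q, hqq, hqm, hq', hq₁, hq₂, hB, hinv₁, hinv₂⟩ := exists_block_projection hc hU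
  have hqi : ∀ l, q * x.2.1 l = x.2.1 l := fun l => matrix_ext_mulVec fun w => by
    rw [← Matrix.mulVec_mulVec, hq₁ _ (hi l w)]
  let c : ℂ → ADHMSpace n m := fun s =>
    (fun k l => blockDiag q (x.1 k l) + s • (q * x.1 k l * (1 - q)), x.2.1,
      fun l => x.2.2 l * (q + s • (1 - q)))
  have hcc : Continuous c := by fun_prop
  obtain ⟨g, hg⟩ := mem_orbit_of_punctured h hcc fun s hs => by
    refine ⟨idempotentScaling q hqq 1 s⁻¹ one_ne_zero (inv_ne_zero hs), ?_⟩
    refine Prod.ext (funext fun k => funext fun l => ?_) (Prod.ext (funext fun l => ?_)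
      (funext fun l => ?_))
    · have := scaling_conj (hB k l) one_ne_zero (inv_ne_zero hs)
      simp only [one_mul, inv_inv] at this
      simp [c, ADHMAct, idempotentScaling, ← this]
    · simp [c, ADHMAct, idempotentScaling, Matrix.add_mul, Matrix.sub_mul, hqi]
    · simp [c, ADHMAct, idempotentScaling]
  refine ⟨_, _, IsSplitting.of_act (g := g) (U₁ := U) (U₂ := U') ?_,
    LinearEquiv.finrank_map_eq _ U⟩
  rw [← hg]
  refine ⟨hc, ?_, ?_, hi, ?_⟩
  · simpa [c, BInvariant] using hinv₁
  · simpa [c, BInvariant] using hinv₂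
  · intro l v hv
    simp [c, ← Matrix.mulVec_mulVec, hq₂ v hv]

lemma exists_splitting_of_inKernels {x : ADHMSpace n m} (h : IsClosed (orbit x))
    {U : Submodule ℂ (Fin n → ℂ)} (hU : BInvariant x U) (hj : InKernels x U) :
    ∃ U₁ U₂, IsSplitting x U₁ U₂ ∧ Module.finrank ℂ U₂ = Module.finrank ℂ U := by
  obtain ⟨U', hc⟩ := U.exists_isCompl
  obtain ⟨q, hqq, hqm, hq', hq₁, hq₂, hB, hinv₁, hinv₂⟩ := exists_block_projection hc hU
  have hqj : ∀ l, x.2.2 l * q = 0 := fun l => matrix_ext_mulVec fun v => by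
    rw [← Matrix.mulVec_mulVec, hj l _ (hqm v), Matrix.zero_mulVec]
  let c : ℂ → ADHMSpace n m := fun s =>
    (fun k l => blockDiag q (x.1 k l) + s • (q * x.1 k l * (1 - q)),
      fun l => (s • q + (1 - q)) * x.2.1 l, x.2.2)
  have hcc : Continuous c := by fun_prop
  obtain ⟨g, hg⟩ := mem_orbit_of_punctured h hcc fun s hs => by
    refine ⟨idempotentScaling q hqq s 1 hs one_ne_zero, ?_⟩
    refine Prod.ext (funext fun k => funext fun l => ?_) (Prod.ext (funext fun l => ?_)
      (funext fun l => ?_))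
    · have := scaling_conj (hB k l) hs one_ne_zero
      simp only [one_smul, inv_one, mul_one] at this
      simp [c, ADHMAct, idempotentScaling, ← this]
    · simp [c, ADHMAct, idempotentScaling]
    · simp [c, ADHMAct, idempotentScaling, Matrix.mul_add, Matrix.mul_sub, hqj]
  refine ⟨_, _, IsSplitting.of_act (g := g) (U₁ := U') (U₂ := U) ?_,
    LinearEquiv.finrank_map_eq _ U⟩
  rw [← hg]
  refine ⟨hc.symm, ?_, ?_, ?_, hj⟩
  · simpa [c, BInvariant] using hinv₂
  · simpa [c, BInvariant] using hinv₁
  · intro l w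
    simp only [c, zero_smul, zero_add, ← Matrix.mulVec_mulVec, Matrix.sub_mulVec,
      Matrix.one_mulVec]
    exact hq' _

lemma isSplitting_cores {x : ADHMSpace n m} (h : IsClosed (orbit x)) :
    IsSplitting x (stableCore x) (costableCore x) := by
  have hS := bInvariant_stableCore x
  have hT := bInvariant_costableCore x
  have hSi := containsImages_stableCore x
  have hTj := inKernels_costableCore x
  refine ⟨?_, hS, hT, hSi, hTj⟩
  obtain ⟨U₁, U₂, ⟨hc, h₁, h₂, hi, hj⟩, hr⟩ := exists_splitting_of_containsImages h hS hSi
  obtain rfl := Submodule.eq_of_le_of_finrank_eq (stableCore_le h₁ hi) hr.symm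
  obtain ⟨U₃, U₄, ⟨hc', h₃, h₄, hi', hj'⟩, hr'⟩ := exists_splitting_of_inKernels h hT hTj
  obtain rfl := Submodule.eq_of_le_of_finrank_eq (le_costableCore h₄ hj') hr'
  exact ⟨hc'.disjoint.mono_left (stableCore_le h₃ hi'),
    hc.codisjoint.mono_right (le_costableCore h₂ hj)⟩

/-- The conjugacy class of a family of square matrices. -/
abbrev conjClass (M : Fin 2 → Fin 2 → Matrix (Fin p) (Fin p) ℂ) :
    Set (Fin 2 → Fin 2 → Matrix (Fin p) (Fin p) ℂ) :=
  {C | ∃ g : (Matrix (Fin p) (Fin p) ℂ)ˣ, ∀ k l : Fin 2,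
    C k l = (g : Matrix (Fin p) (Fin p) ℂ) * M k l *
      ((g⁻¹ : (Matrix (Fin p) (Fin p) ℂ)ˣ) : Matrix (Fin p) (Fin p) ℂ)}

/-- Matrices splitting `V` into the kernel of `E` and the range of `F`, compatibly with `x`. -/
structure MatrixSplitting (x : ADHMSpace n m) (E : Matrix (Fin p) (Fin n) ℂ)
    (F : Matrix (Fin n) (Fin p) ℂ) : Prop where
  mul_eq_one : E * F = 1
  comm : ∀ k l, x.1 k l * (F * E) = F * E * x.1 k l
  mul_i : ∀ l, E * x.2.1 l = 0
  j_mul : ∀ l, x.2.2 l * F = 0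

lemma IsSplitting.exists_matrixSplitting {x : ADHMSpace n m}
    {U₁ U₂ : Submodule ℂ (Fin n → ℂ)} (h : IsSplitting x U₁ U₂) (φ : U₂ ≃ₗ[ℂ] (Fin p → ℂ)) :
    ∃ (E : Matrix (Fin p) (Fin n) ℂ) (F : Matrix (Fin n) (Fin p) ℂ), MatrixSplitting x E F ∧
      (∀ w, F *ᵥ w = φ.symm w) ∧ (∀ v, v ∈ U₁ ↔ E *ᵥ v = 0) ∧
      (∀ v ∈ U₂, F *ᵥ (E *ᵥ v) = v) := by
  obtain ⟨hc, h₁, h₂, hi, hj⟩ := h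
  obtain ⟨E, F, hF, hEF, hE₁, hE₂⟩ := exists_matrix_splitting hc φ
  refine ⟨E, F, ⟨hEF, fun k l => matrix_ext_mulVec fun v => ?_, fun l =>
    matrix_ext_mulVec fun w => ?_, fun l => matrix_ext_mulVec fun w => ?_⟩, hF,
    fun v => ⟨hE₁ v, fun hv => ?_⟩, hE₂⟩
  · obtain ⟨a, ha, b, hb, rfl⟩ := Submodule.mem_sup.1
      (hc.sup_eq_top ▸ Submodule.mem_top : v ∈ U₁ ⊔ U₂)
    simp only [← Matrix.mulVec_mulVec, Matrix.mulVec_add, hE₁ a ha, hE₁ _ (h₁ k l a ha),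
      hE₂ b hb, hE₂ _ (h₂ k l b hb), Matrix.mulVec_zero]
  · rw [← Matrix.mulVec_mulVec, hE₁ _ (hi l w), Matrix.zero_mulVec]
  · rw [← Matrix.mulVec_mulVec, hF, hj l _ (φ.symm w).2, Matrix.zero_mulVec]
  · obtain ⟨a, ha, b, hb, rfl⟩ := Submodule.mem_sup.1
      (hc.sup_eq_top ▸ Submodule.mem_top : v ∈ U₁ ⊔ U₂)
    rw [Matrix.mulVec_add, hE₁ a ha, zero_add] at hv
    rw [← hE₂ b hb, hv]
    simpa using ha

namespace MatrixSplitting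

variable {x : ADHMSpace n m} {E : Matrix (Fin p) (Fin n) ℂ} {F : Matrix (Fin n) (Fin p) ℂ}

lemma mul_right_block (h : MatrixSplitting x E F) (k l : Fin 2) :
    x.1 k l * F = F * (E * x.1 k l * F) := by
  calc x.1 k l * F = x.1 k l * (F * E) * F := by
        rw [Matrix.mul_assoc, Matrix.mul_assoc, h.mul_eq_one, Matrix.mul_one]
    _ = F * (E * x.1 k l * F) := by rw [h.comm]; simp only [Matrix.mul_assoc]

lemma mul_left_block (h : MatrixSplitting x E F) (k l : Fin 2) :
    E * x.1 k l = (E * x.1 k l * F) * E := by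
  calc E * x.1 k l = E * (F * E * x.1 k l) := by
        rw [← Matrix.mul_assoc, ← Matrix.mul_assoc, h.mul_eq_one, Matrix.one_mul]
    _ = (E * x.1 k l * F) * E := by rw [← h.comm]; simp only [Matrix.mul_assoc]

/-- The extension of a block automorphism by the identity on the kernel of `E`. -/
noncomputable def extendUnit (h : E * F = 1) (g : (Matrix (Fin p) (Fin p) ℂ)ˣ) :
    (Matrix (Fin n) (Fin n) ℂ)ˣ where
  val := 1 - F * E + F * (g : Matrix (Fin p) (Fin p) ℂ) * E
  inv := 1 - F * E + F * ((g⁻¹ : (Matrix (Fin p) (Fin p) ℂ)ˣ) : Matrix (Fin p) (Fin p) ℂ) * E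
  val_inv := by
    have h' : ∀ X : Matrix (Fin p) (Fin n) ℂ, E * (F * X) = X := fun X => by
      rw [← Matrix.mul_assoc, h, Matrix.one_mul]
    have hg : ∀ X : Matrix (Fin p) (Fin n) ℂ, (g : Matrix (Fin p) (Fin p) ℂ) *
        (((g⁻¹ : (Matrix (Fin p) (Fin p) ℂ)ˣ) : Matrix (Fin p) (Fin p) ℂ) * X) = X := fun X => by
      rw [← Matrix.mul_assoc, Units.mul_inv, Matrix.one_mul]
    simp only [Matrix.mul_add, Matrix.add_mul, Matrix.mul_sub, Matrix.sub_mul, Matrix.mul_assoc,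
      h', hg, Matrix.mul_one, Matrix.one_mul]
    abel
  inv_val := by
    have h' : ∀ X : Matrix (Fin p) (Fin n) ℂ, E * (F * X) = X := fun X => by
      rw [← Matrix.mul_assoc, h, Matrix.one_mul]
    have hg : ∀ X : Matrix (Fin p) (Fin n) ℂ,
        ((g⁻¹ : (Matrix (Fin p) (Fin p) ℂ)ˣ) : Matrix (Fin p) (Fin p) ℂ) *
        ((g : Matrix (Fin p) (Fin p) ℂ) * X) = X := fun X => by
      rw [← Matrix.mul_assoc, Units.inv_mul, Matrix.one_mul]
    simp only [Matrix.mul_add, Matrix.add_mul, Matrix.mul_sub, Matrix.sub_mul, Matrix.mul_assoc,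
      h', hg, Matrix.mul_one, Matrix.one_mul]
    abel

/-- The datum obtained from `x` by replacing its block on the range of `F` with `C`. -/
def replaceBlock (x : ADHMSpace n m) (E : Matrix (Fin p) (Fin n) ℂ)
    (F : Matrix (Fin n) (Fin p) ℂ) (C : Fin 2 → Fin 2 → Matrix (Fin p) (Fin p) ℂ) :
    ADHMSpace n m :=
  (fun k l => (1 - F * E) * x.1 k l + F * C k l * E, x.2)

lemma replaceBlock_conj (h : MatrixSplitting x E F) (g : (Matrix (Fin p) (Fin p) ℂ)ˣ) :
    replaceBlock x E F (fun k l => (g : Matrix (Fin p) (Fin p) ℂ) * (E * x.1 k l * F) *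
      ((g⁻¹ : (Matrix (Fin p) (Fin p) ℂ)ˣ) : Matrix (Fin p) (Fin p) ℂ)) =
      ADHMAct (extendUnit h.mul_eq_one g) x := by
  have h' : ∀ {c} (X : Matrix (Fin p) (Fin c) ℂ), E * (F * X) = X := fun X => by
    rw [← Matrix.mul_assoc, h.mul_eq_one, Matrix.one_mul]
  refine Prod.ext (funext fun k => funext fun l => ?_) (Prod.ext (funext fun l => ?_)
    (funext fun l => ?_))
  · have hBF := h.mul_right_block k l
    have hEB := h.mul_left_block k l
    simp only [replaceBlock, ADHMAct, extendUnit, Units.inv_mk]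
    generalize E * x.1 k l * F = D at hBF hEB ⊢
    have hBF' : ∀ X : Matrix (Fin p) (Fin n) ℂ, x.1 k l * (F * X) = F * (D * X) := fun X => by
      rw [← Matrix.mul_assoc, hBF, Matrix.mul_assoc]
    simp only [Matrix.mul_add, Matrix.add_mul, Matrix.mul_sub, Matrix.sub_mul, Matrix.mul_assoc,
      h', hBF', hEB, Matrix.mul_one, Matrix.one_mul]
    abel
  · simp [replaceBlock, ADHMAct, extendUnit, Matrix.add_mul, Matrix.sub_mul, Matrix.mul_assoc,
      h.mul_i]
  · simp [replaceBlock, ADHMAct, extendUnit, Matrix.mul_add, Matrix.mul_sub,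
      ← Matrix.mul_assoc, h.j_mul]

lemma mem_conjClass_of_replaceBlock (h : MatrixSplitting x E F)
    (hS : ∀ v, v ∈ stableCore x ↔ E *ᵥ v = 0)
    {C : Fin 2 → Fin 2 → Matrix (Fin p) (Fin p) ℂ} (hC : replaceBlock x E F C ∈ orbit x) :
    C ∈ conjClass (fun k l => E * x.1 k l * F) := by
  obtain ⟨g, hg⟩ := hC
  have h' : ∀ {c} (X : Matrix (Fin p) (Fin c) ℂ), E * (F * X) = X := fun X => by
    rw [← Matrix.mul_assoc, h.mul_eq_one, Matrix.one_mul]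
  have hER : ∀ k l, E * (replaceBlock x E F C).1 k l = C k l * E := fun k l => by
    simp only [replaceBlock, Matrix.mul_add, Matrix.sub_mul, Matrix.mul_sub, Matrix.mul_assoc,
      h', Matrix.one_mul, sub_self, zero_add]
  have hle : ∀ v, E *ᵥ v = 0 → E *ᵥ ((g : Matrix (Fin n) (Fin n) ℂ) *ᵥ v) = 0 := by
    intro v hv
    have hB : BInvariant (ADHMAct g x) (stableCore x) := by
      rw [← hg]
      intro k l v hv
      rw [hS] at hv ⊢
      rw [Matrix.mulVec_mulVec, hER, ← Matrix.mulVec_mulVec, hv, Matrix.mulVec_zero]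
    have hI : ContainsImages (ADHMAct g x) (stableCore x) := by
      rw [← hg]
      exact containsImages_stableCore x
    have := stableCore_le hB.of_act hI.of_act ((hS v).2 hv)
    rwa [mem_map_mulVecEquiv_symm, hS] at this
  have hEG : E * (g : Matrix (Fin n) (Fin n) ℂ) = E * (g : Matrix (Fin n) (Fin n) ℂ) * F * E := by
    refine matrix_ext_mulVec fun v => ?_
    have := hle (v - F *ᵥ (E *ᵥ v)) (by
      rw [Matrix.mulVec_sub, Matrix.mulVec_mulVec, h.mul_eq_one, Matrix.one_mulVec, sub_self])
    simpa only [Matrix.mulVec_sub, Matrix.mulVec_mulVec, sub_eq_zero, Matrix.mul_assoc] using this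
  set G := (g : Matrix (Fin n) (Fin n) ℂ)
  set G' := ((g⁻¹ : (Matrix (Fin n) (Fin n) ℂ)ˣ) : Matrix (Fin n) (Fin n) ℂ)
  have hGG : G * G' = 1 := g.mul_inv
  have hGG' : G' * G = 1 := g.inv_mul
  have hkk : (E * G * F) * (E * G' * F) = 1 := by
    calc (E * G * F) * (E * G' * F) = (E * G * F * E) * G' * F := by
          simp only [Matrix.mul_assoc]
      _ = 1 := by rw [← hEG, Matrix.mul_assoc E, hGG, Matrix.mul_one, h.mul_eq_one]
  refine ⟨⟨E * G * F, E * G' * F, hkk, mul_eq_one_comm.1 hkk⟩, fun k l => ?_⟩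
  have hCk : C k l * (E * G * F) = (E * G * F) * (E * x.1 k l * F) := by
    calc C k l * (E * G * F) = C k l * E * G * F := by simp only [Matrix.mul_assoc]
      _ = E * (G * x.1 k l * G') * G * F := by rw [← hER, hg]; rfl
      _ = E * G * (x.1 k l * F) := by
          simp only [Matrix.mul_assoc]
          rw [← Matrix.mul_assoc G', hGG', Matrix.one_mul]
      _ = (E * G * F) * (E * x.1 k l * F) := by
          rw [h.mul_right_block]; simp only [Matrix.mul_assoc]
  change C k l = (E * G * F) * (E * x.1 k l * F) * (E * G' * F)
  rw [← hCk, Matrix.mul_assoc, hkk, Matrix.mul_one]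

lemma isClosed_conjClass (h : MatrixSplitting x E F)
    (hS : ∀ v, v ∈ stableCore x ↔ E *ᵥ v = 0) (hx : IsClosed (orbit x)) :
    IsClosed (conjClass (fun k l => E * x.1 k l * F)) := by
  have hcont : Continuous (replaceBlock x E F) := by
    unfold replaceBlock
    fun_prop
  convert hx.preimage hcont using 1
  ext C
  refine ⟨fun ⟨g, hg⟩ => ⟨extendUnit h.mul_eq_one g, ?_⟩, h.mem_conjClass_of_replaceBlock hS⟩
  obtain rfl : C = _ := funext fun k => funext fun l => hg k l
  exact h.replaceBlock_conj g

end MatrixSplitting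

lemma exists_goodDecomp {x : ADHMSpace n m} (hx : IsClosed (orbit x)) :
    ADHMGoodDecomp x (stableCore x) (costableCore x) := by
  have h := isSplitting_cores hx
  let φ : costableCore x ≃ₗ[ℂ] (Fin (Module.finrank ℂ (costableCore x)) → ℂ) :=
    LinearEquiv.ofFinrankEq _ _ (by simp)
  obtain ⟨E, F, hEF, hF, hS, hT⟩ := h.exists_matrixSplitting φ
  obtain ⟨hc, h₁, h₂, hi, hj⟩ := h
  refine ⟨hc, (bInvariant_iff x _).2 h₁, (bInvariant_iff x _).2 h₂, (containsImages_iff x _).2 hi,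
    (inKernels_iff x _).2 hj, ?_, ?_, _, φ, fun k l => E * x.1 k l * F, ?_,
    hEF.isClosed_conjClass hS hx⟩
  · intro S hlt hS hSi
    exact hlt.not_ge (stableCore_le ((bInvariant_iff x S).1 hS) ((containsImages_iff x S).1 hSi))
  · intro S hle hne hS hSj
    exact hne (le_bot_iff.1 (hc.disjoint hle
      (le_costableCore ((bInvariant_iff x S).1 hS) ((inKernels_iff x S).1 hSj))))
  · intro k l w
    rw [← hF, ← hF, Matrix.mulVec_mulVec, Matrix.mulVec_mulVec, ← hEF.mul_right_block]

open Filter Topology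

/-- The vectors on which a sequence of matrices converges. -/
def convergenceSubspace (A : ℕ → Matrix (Fin n) (Fin n) ℂ) : Submodule ℂ (Fin n → ℂ) where
  carrier := {v | ∃ v', Tendsto (fun k => A k *ᵥ v) atTop (𝓝 v')}
  zero_mem' := ⟨0, by simp⟩
  add_mem' := by
    rintro u v ⟨u', hu⟩ ⟨v', hv⟩
    exact ⟨u' + v', by simpa only [Matrix.mulVec_add] using hu.add hv⟩
  smul_mem' := by
    rintro c v ⟨v', hv⟩
    exact ⟨c • v', by simpa only [Matrix.mulVec_smul] using hv.const_smul c⟩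

lemma mulVec_mem_convergenceSubspace {A B : ℕ → Matrix (Fin n) (Fin n) ℂ}
    {B₀ B' : Matrix (Fin n) (Fin n) ℂ} (h : ∀ k, A k * B₀ = B k * A k)
    (hB : Tendsto B atTop (𝓝 B')) {v : Fin n → ℂ} (hv : v ∈ convergenceSubspace A) :
    B₀ *ᵥ v ∈ convergenceSubspace A := by
  obtain ⟨v', hv⟩ := hv
  refine ⟨B' *ᵥ v', ?_⟩
  have hcont : Continuous fun q : Matrix (Fin n) (Fin n) ℂ × (Fin n → ℂ) => q.1 *ᵥ q.2 := by
    fun_prop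
  simp only [Matrix.mulVec_mulVec, h]
  simpa only [Matrix.mulVec_mulVec, Function.comp_def] using (hcont.tendsto (B', v')).comp (hB.prodMk_nhds hv)

lemma mulVec_mem_convergenceSubspace_of_tendsto {A : ℕ → Matrix (Fin n) (Fin n) ℂ}
    {I I' : Matrix (Fin n) (Fin m) ℂ} (h : Tendsto (fun k => A k * I) atTop (𝓝 I'))
    (w : Fin m → ℂ) : I *ᵥ w ∈ convergenceSubspace A := by
  refine ⟨I' *ᵥ w, ?_⟩
  have hcont : Continuous fun q : Matrix (Fin n) (Fin m) ℂ => q *ᵥ w := by fun_prop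
  simpa only [Matrix.mulVec_mulVec, Function.comp_def] using (hcont.tendsto I').comp h

lemma exists_tendsto_mul {A : ℕ → Matrix (Fin n) (Fin n) ℂ} {e : Matrix (Fin n) (Fin n) ℂ}
    (h : ∀ c, eᵀ c ∈ convergenceSubspace A) :
    ∃ a, Tendsto (fun k => A k * e) atTop (𝓝 a) := by
  choose a ha using h
  refine ⟨Matrix.of fun r c => a c r, ?_⟩
  refine tendsto_pi_nhds.2 fun r => tendsto_pi_nhds.2 fun c => ?_
  exact tendsto_pi_nhds.1 (ha c) r

lemma exists_tendsto_act_mul {x y : ADHMSpace n m} {g : ℕ → (Matrix (Fin n) (Fin n) ℂ)ˣ}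
    (hg : Tendsto (fun k => ADHMAct (g k) x) atTop (𝓝 y)) {e : Matrix (Fin n) (Fin n) ℂ}
    (he : ∀ v, e *ᵥ v ∈ stableCore x) :
    ∃ a, Tendsto (fun k => (g k : Matrix (Fin n) (Fin n) ℂ) * e) atTop (𝓝 a) := by
  have hle : stableCore x ≤
      convergenceSubspace fun k => (g k : Matrix (Fin n) (Fin n) ℂ) := by
    refine stableCore_le (fun k l v hv => ?_) fun l w => ?_
    · refine mulVec_mem_convergenceSubspace (B := fun i => (ADHMAct (g i) x).1 k l)
        (B' := y.1 k l) (fun i => ?_) ?_ hv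
      · simp [ADHMAct, Matrix.mul_assoc]
      · have hcont : Continuous fun z : ADHMSpace n m => z.1 k l := by fun_prop
        exact (hcont.tendsto y).comp hg
    · have hcont : Continuous fun z : ADHMSpace n m => z.2.1 l := by fun_prop
      exact mulVec_mem_convergenceSubspace_of_tendsto ((hcont.tendsto y).comp hg) w
  refine exists_tendsto_mul fun c => hle ?_
  have := he (Pi.single c 1)
  rwa [Matrix.mulVec_single_one] at this

lemma exists_tendsto_mul_act {x y : ADHMSpace n m} {g : ℕ → (Matrix (Fin n) (Fin n) ℂ)ˣ}
    (hg : Tendsto (fun k => ADHMAct (g k) x) atTop (𝓝 y)) {e : Matrix (Fin n) (Fin n) ℂ}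
    (he : ∀ v ∈ costableCore x, e *ᵥ v = 0) :
    ∃ b, Tendsto (fun k => e *
      (((g k)⁻¹ : (Matrix (Fin n) (Fin n) ℂ)ˣ) : Matrix (Fin n) (Fin n) ℂ)) atTop (𝓝 b) := by
  let A : ℕ → Matrix (Fin n) (Fin n) ℂ := fun k =>
    (((g k)⁻¹ : (Matrix (Fin n) (Fin n) ℂ)ˣ) : Matrix (Fin n) (Fin n) ℂ)ᵀ
  have hTB : ∀ k l, ∀ u ∈ convergenceSubspace A, (x.1 k l)ᵀ *ᵥ u ∈ convergenceSubspace A := by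
    intro k l u hu
    refine mulVec_mem_convergenceSubspace (B := fun i => ((ADHMAct (g i) x).1 k l)ᵀ)
      (B' := (y.1 k l)ᵀ) (fun i => ?_) ?_ hu
    · rw [← Matrix.transpose_mul, ← Matrix.transpose_mul]
      simp [ADHMAct, ← Matrix.mul_assoc]
    · have hcont : Continuous fun z : ADHMSpace n m => (z.1 k l)ᵀ := by fun_prop
      exact (hcont.tendsto y).comp hg
  have hTj : ∀ l w, (x.2.2 l)ᵀ *ᵥ w ∈ convergenceSubspace A := by
    intro l w
    have hcont : Continuous fun z : ADHMSpace n m => (z.2.2 l)ᵀ := by fun_prop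
    have := (hcont.tendsto y).comp hg
    refine mulVec_mem_convergenceSubspace_of_tendsto (I' := (y.2.2 l)ᵀ) ?_ w
    simpa only [A, ADHMAct, Function.comp_def, Matrix.transpose_mul] using this
  let N : Submodule ℂ (Fin n → ℂ) :=
    { carrier := {v | ∀ u ∈ convergenceSubspace A, u ⬝ᵥ v = 0}
      zero_mem' := fun u _ => dotProduct_zero u
      add_mem' := fun {a b} ha hb u hu => by rw [dotProduct_add, ha u hu, hb u hu, add_zero]
      smul_mem' := fun c a ha u hu => by rw [dotProduct_smul, ha u hu, smul_zero] }
  have hN : N ≤ costableCore x := by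
    refine le_costableCore (fun k l v hv u hu => ?_) fun l v hv => ?_
    · rw [Matrix.dotProduct_mulVec, ← Matrix.mulVec_transpose]
      exact hv _ (hTB k l u hu)
    · refine dotProduct_eq_zero _ fun w => ?_
      rw [dotProduct_comm, Matrix.dotProduct_mulVec, ← Matrix.mulVec_transpose]
      exact hv _ (hTj l w)
  have hrow : ∀ r, e r ∈ convergenceSubspace A := by
    intro r
    by_contra hr
    obtain ⟨f, hf, hker⟩ := Submodule.exists_le_ker_of_notMem hr
    obtain ⟨v, rfl⟩ := (dotProductEquiv ℂ (Fin n)).surjective f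
    have hv : v ∈ N := fun u hu => by
      rw [dotProduct_comm]
      exact hker hu
    apply hf
    rw [dotProductEquiv_apply_apply, dotProduct_comm]
    exact congrFun (he v (hN hv)) r
  obtain ⟨b, hb⟩ := exists_tendsto_mul (e := eᵀ) hrow
  refine ⟨bᵀ, ?_⟩
  have hcont : Continuous fun z : Matrix (Fin n) (Fin n) ℂ => zᵀ := by fun_prop
  have := (hcont.tendsto b).comp hb
  simpa only [A, Function.comp_def, Matrix.transpose_mul, Matrix.transpose_transpose] using this

/-- The relations satisfied by `a = g e`, `b = e g⁻¹` and `y = g · x`, for an idempotent `e`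
commuting with `x`; they are closed conditions on `(y, a, b)`. -/
structure PartialIntertwiner (x y : ADHMSpace n m) (e a b : Matrix (Fin n) (Fin n) ℂ) : Prop where
  b_mul_a : b * a = e
  a_mul_e : a * e = a
  e_mul_b : e * b = b
  comm_a : ∀ k l, y.1 k l * a = a * x.1 k l
  b_comm : ∀ k l, b * y.1 k l = x.1 k l * b
  i_eq : ∀ l, y.2.1 l = a * x.2.1 l
  j_eq : ∀ l, y.2.2 l = x.2.2 l * b

lemma partialIntertwiner_iff {x y : ADHMSpace n m} {e a b : Matrix (Fin n) (Fin n) ℂ} :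
    PartialIntertwiner x y e a b ↔ b * a = e ∧ a * e = a ∧ e * b = b ∧
      (∀ k l, y.1 k l * a = a * x.1 k l) ∧ (∀ k l, b * y.1 k l = x.1 k l * b) ∧
      (∀ l, y.2.1 l = a * x.2.1 l) ∧ (∀ l, y.2.2 l = x.2.2 l * b) :=
  ⟨fun ⟨h₁, h₂, h₃, h₄, h₅, h₆, h₇⟩ => ⟨h₁, h₂, h₃, h₄, h₅, h₆, h₇⟩,
    fun ⟨h₁, h₂, h₃, h₄, h₅, h₆, h₇⟩ => ⟨h₁, h₂, h₃, h₄, h₅, h₆, h₇⟩⟩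

lemma partialIntertwiner_act {x : ADHMSpace n m} {e : Matrix (Fin n) (Fin n) ℂ}
    (he : e * e = e) (hB : ∀ k l, x.1 k l * e = e * x.1 k l) (hi : ∀ l, e * x.2.1 l = x.2.1 l)
    (hj : ∀ l, x.2.2 l * e = x.2.2 l) (g : (Matrix (Fin n) (Fin n) ℂ)ˣ) :
    PartialIntertwiner x (ADHMAct g x) e (g * e)
      (e * ((g⁻¹ : (Matrix (Fin n) (Fin n) ℂ)ˣ) : Matrix (Fin n) (Fin n) ℂ)) where
  b_mul_a := by
    rw [mul_assoc, Units.inv_mul_cancel_left, he]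
  a_mul_e := by rw [mul_assoc, he]
  e_mul_b := by rw [← mul_assoc, he]
  comm_a k l := by
    simp only [ADHMAct, mul_assoc, Units.inv_mul_cancel_left, hB]
  b_comm k l := by
    simp only [ADHMAct, mul_assoc, Units.inv_mul_cancel_left]
    rw [← mul_assoc, ← hB, mul_assoc]
  i_eq l := by
    rw [Matrix.mul_assoc, hi]
    rfl
  j_eq l := by
    rw [← Matrix.mul_assoc, hj]
    rfl

lemma isClosed_partialIntertwiner (x : ADHMSpace n m) (e : Matrix (Fin n) (Fin n) ℂ) :
    IsClosed {z : ADHMSpace n m × Matrix (Fin n) (Fin n) ℂ × Matrix (Fin n) (Fin n) ℂ |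
      PartialIntertwiner x z.1 e z.2.1 z.2.2} := by
  simp only [partialIntertwiner_iff, Set.ofPred_and, Set.ofPred_forall]
  refine .inter ?_ <| .inter ?_ <| .inter ?_ <| .inter ?_ <| .inter ?_ <| .inter ?_ ?_
  all_goals
    repeat refine isClosed_iInter fun _ => ?_
    exact isClosed_eq (by fun_prop) (by fun_prop)

namespace MatrixSplitting

variable {x y : ADHMSpace n m} {E E' : Matrix (Fin p) (Fin n) ℂ}
  {F F' : Matrix (Fin n) (Fin p) ℂ} {a b : Matrix (Fin n) (Fin n) ℂ}

lemma mem_orbit_of_partialIntertwiner (h : MatrixSplitting x E F)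
    (hp : PartialIntertwiner x y (1 - F * E) a b) (hEF : E' * F' = 1) (hFE : F' * E' = 1 - a * b)
    (hC : (fun k l => E' * y.1 k l * F') ∈ conjClass fun k l => E * x.1 k l * F) :
    y ∈ orbit x := by
  obtain ⟨κ, hκ⟩ := hC
  have haF : a * F = 0 := by
    rw [← hp.a_mul_e, Matrix.mul_assoc, Matrix.sub_mul, Matrix.mul_assoc, h.mul_eq_one]
    simp
  have hEb : E * b = 0 := by
    rw [← hp.e_mul_b, ← Matrix.mul_assoc, Matrix.mul_sub, ← Matrix.mul_assoc, h.mul_eq_one]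
    simp
  have hbF : b * F' = 0 := by
    have : b * (F' * E') = 0 := by
      rw [hFE, mul_sub, mul_one, ← mul_assoc, hp.b_mul_a, hp.e_mul_b, sub_self]
    rw [← Matrix.mul_one (b * F'), ← hEF, ← Matrix.mul_assoc, Matrix.mul_assoc b, this,
      Matrix.zero_mul]
  set K := (κ : Matrix (Fin p) (Fin p) ℂ)
  set K' := ((κ⁻¹ : (Matrix (Fin p) (Fin p) ℂ)ˣ) : Matrix (Fin p) (Fin p) ℂ)
  have hKK : K * K' = 1 := κ.mul_inv
  have hKK' : K' * K = 1 := κ.inv_mul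
  have hg : (a + F' * K * E) * (b + F * K' * E') = 1 := by
    have h₁ : a * (F * K' * E') = 0 := by
      rw [Matrix.mul_assoc, ← Matrix.mul_assoc a, haF, Matrix.zero_mul]
    have h₂ : F' * K * E * b = 0 := by
      rw [Matrix.mul_assoc, hEb, Matrix.mul_zero]
    have h₃ : F' * K * E * (F * K' * E') = F' * E' := by
      calc F' * K * E * (F * K' * E') = F' * (K * ((E * F) * K')) * E' := by
            simp only [Matrix.mul_assoc]
        _ = F' * E' := by rw [h.mul_eq_one, Matrix.one_mul, hKK, Matrix.mul_one]
    rw [add_mul, mul_add, mul_add, h₁, h₂, h₃, hFE]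
    abel
  have hB : ∀ k l, y.1 k l * (a + F' * K * E) = (a + F' * K * E) * x.1 k l := by
    intro k l
    have hyF : y.1 k l * F' = F' * (E' * y.1 k l * F') := by
      calc y.1 k l * F' = y.1 k l * (F' * E') * F' := by
            rw [Matrix.mul_assoc, Matrix.mul_assoc, hEF, Matrix.mul_one]
        _ = (F' * E') * y.1 k l * F' := by
            rw [hFE, mul_sub, sub_mul, ← mul_assoc, hp.comm_a, mul_assoc, ← hp.b_comm]
            simp only [mul_assoc, mul_one, one_mul]
        _ = F' * (E' * y.1 k l * F') := by simp only [Matrix.mul_assoc]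
    have hCK : E' * y.1 k l * F' * K = K * (E * x.1 k l * F) := by
      rw [show E' * y.1 k l * F' = K * (E * x.1 k l * F) * K' from hκ k l, Matrix.mul_assoc, hKK', Matrix.mul_one]
    rw [mul_add, add_mul, hp.comm_a]
    congr 1
    calc y.1 k l * (F' * K * E) = (y.1 k l * F') * K * E := by simp only [Matrix.mul_assoc]
      _ = F' * (E' * y.1 k l * F' * K) * E := by rw [hyF]; simp only [Matrix.mul_assoc]
      _ = F' * K * (E * x.1 k l * F * E) := by rw [hCK]; simp only [Matrix.mul_assoc]
      _ = F' * K * E * x.1 k l := by rw [← h.mul_left_block]; simp only [Matrix.mul_assoc]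
  refine ⟨⟨a + F' * K * E, b + F * K' * E', hg, mul_eq_one_comm.1 hg⟩, ?_⟩
  refine Prod.ext (funext fun k => funext fun l => ?_) (Prod.ext (funext fun l => ?_)
    (funext fun l => ?_))
  · change y.1 k l = (a + F' * K * E) * x.1 k l * (b + F * K' * E')
    rw [← hB, mul_assoc, hg, mul_one]
  · change y.2.1 l = (a + F' * K * E) * x.2.1 l
    rw [hp.i_eq, Matrix.add_mul, Matrix.mul_assoc (F' * K), h.mul_i, Matrix.mul_zero, add_zero]
  · change y.2.2 l = x.2.2 l * (b + F * K' * E')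
    rw [hp.j_eq, Matrix.mul_add, ← Matrix.mul_assoc, ← Matrix.mul_assoc, h.j_mul,
      Matrix.zero_mul, Matrix.zero_mul, add_zero]

lemma block_mem_conjClass (h : MatrixSplitting x E F)
    (hcl : IsClosed (conjClass fun k l => E * x.1 k l * F))
    {g : ℕ → (Matrix (Fin n) (Fin n) ℂ)ˣ}
    (hg : Tendsto (fun k => ADHMAct (g k) x) atTop (𝓝 y))
    (hab : Tendsto (fun k => (g k : Matrix (Fin n) (Fin n) ℂ) * (1 - F * E) *
      (((g k)⁻¹ : (Matrix (Fin n) (Fin n) ℂ)ˣ) : Matrix (Fin n) (Fin n) ℂ)) atTop (𝓝 (a * b)))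
    (hEF : E' * F' = 1) (hFE : F' * E' = 1 - a * b) :
    (fun k l => E' * y.1 k l * F') ∈ conjClass fun k l => E * x.1 k l * F := by
  set e : ℕ → Matrix (Fin n) (Fin n) ℂ := fun k => (g k : Matrix (Fin n) (Fin n) ℂ) *
    (1 - F * E) * (((g k)⁻¹ : (Matrix (Fin n) (Fin n) ℂ)ˣ) : Matrix (Fin n) (Fin n) ℂ) with he
  have he' : ∀ k, 1 - e k = (g k : Matrix (Fin n) (Fin n) ℂ) * F * (E *
      (((g k)⁻¹ : (Matrix (Fin n) (Fin n) ℂ)ˣ) : Matrix (Fin n) (Fin n) ℂ)) := fun k => by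
    simp only [he, mul_sub, sub_mul, mul_one, Units.mul_inv, sub_sub_cancel, Matrix.mul_assoc]
  have hlimF : (1 - a * b) * F' = F' := by
    rw [← hFE, Matrix.mul_assoc, hEF, Matrix.mul_one]
  have hD : Tendsto (fun k => E' * (1 - e k) * F') atTop (𝓝 1) := by
    have hcont : Continuous fun z : Matrix (Fin n) (Fin n) ℂ => E' * (1 - z) * F' := by fun_prop
    have := (hcont.tendsto (a * b)).comp hab
    rwa [Matrix.mul_assoc, hlimF, hEF] at this
  have hDet : Tendsto (fun k => (E' * (1 - e k) * F').det) atTop (𝓝 1) := by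
    have hcont : Continuous fun z : Matrix (Fin p) (Fin p) ℂ => z.det := by fun_prop
    simpa [Function.comp_def] using (hcont.tendsto 1).comp hD
  have hev : ∀ᶠ k in atTop, IsUnit (E' * (1 - e k) * F').det :=
    (hDet.eventually_ne one_ne_zero).mono fun k hk => hk.isUnit
  have hDinv : Tendsto (fun k => (E' * (1 - e k) * F')⁻¹) atTop (𝓝 1) := by
    have := continuousAt_matrix_inv (1 : Matrix (Fin p) (Fin p) ℂ) (by
      rw [Matrix.det_one]
      exact NormedRing.inverse_continuousAt 1)
    simpa [Function.comp_def] using this.tendsto.comp hD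
  have hlim : Tendsto (fun i k l => E' * (ADHMAct (g i) x).1 k l * (1 - e i) * F' *
      (E' * (1 - e i) * F')⁻¹) atTop (𝓝 fun k l => E' * y.1 k l * F') := by
    refine tendsto_pi_nhds.2 fun k => tendsto_pi_nhds.2 fun l => ?_
    have hcont : Continuous fun z : ADHMSpace n m × Matrix (Fin n) (Fin n) ℂ ×
        Matrix (Fin p) (Fin p) ℂ => E' * z.1.1 k l * (1 - z.2.1) * F' * z.2.2 := by fun_prop
    have := (hcont.tendsto (y, a * b, 1)).comp (hg.prodMk_nhds (hab.prodMk_nhds hDinv))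
    simpa only [Function.comp_def, Matrix.mul_one, Matrix.mul_assoc _ _ F', hlimF] using this
  refine hcl.mem_of_tendsto hlim (hev.mono fun i hi => ?_)
  set G := (g i : Matrix (Fin n) (Fin n) ℂ)
  set G' := (((g i)⁻¹ : (Matrix (Fin n) (Fin n) ℂ)ˣ) : Matrix (Fin n) (Fin n) ℂ)
  have hGG' : G' * G = 1 := (g i).inv_mul
  have hD' : E' * (1 - e i) * F' = (E' * G * F) * (E * G' * F') := by
    rw [he']
    simp only [Matrix.mul_assoc, G, G']
  rw [hD'] at hi
  have hkk : (E' * G * F) * ((E * G' * F') * ((E' * G * F) * (E * G' * F'))⁻¹) = 1 := by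
    rw [← Matrix.mul_assoc, Matrix.mul_nonsing_inv _ hi]
  refine ⟨⟨_, _, hkk, mul_eq_one_comm.1 hkk⟩, fun k l => ?_⟩
  change E' * (G * x.1 k l * G') * (1 - e i) * F' * (E' * (1 - e i) * F')⁻¹ =
    (E' * G * F) * (E * x.1 k l * F) * ((E * G' * F') * ((E' * G * F) * (E * G' * F'))⁻¹)
  rw [hD', ← Matrix.mul_assoc ((E' * G * F) * (E * x.1 k l * F))]
  congr 1
  rw [he']
  calc E' * (G * x.1 k l * G') * (G * F * (E * G')) * F'
      = E' * G * (x.1 k l * ((G' * G) * F)) * (E * G' * F') := by simp only [Matrix.mul_assoc]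
    _ = E' * G * F * (E * x.1 k l * F) * (E * G' * F') := by
        rw [hGG', Matrix.one_mul, h.mul_right_block]
        simp only [Matrix.mul_assoc]

lemma isClosed_orbit (h : MatrixSplitting x E F)
    (hS : ∀ v, E *ᵥ v = 0 → v ∈ stableCore x) (hT : ∀ v ∈ costableCore x, F *ᵥ (E *ᵥ v) = v)
    (hcl : IsClosed (conjClass fun k l => E * x.1 k l * F)) : IsClosed (orbit x) := by
  have : SequentialSpace (ADHMSpace n m) := inferInstanceAs (SequentialSpace
    ((Fin 2 → Fin 2 → Fin n → Fin n → ℂ) × (Fin 2 → Fin n → Fin m → ℂ) ×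
      (Fin 2 → Fin m → Fin n → ℂ)))
  refine IsSeqClosed.isClosed fun z y hz hzy => ?_
  choose g hgz using hz
  obtain rfl : z = fun k => ADHMAct (g k) x := funext hgz
  have hEe : E * (1 - F * E) = 0 := by
    rw [Matrix.mul_sub, ← Matrix.mul_assoc, h.mul_eq_one, Matrix.mul_one, Matrix.one_mul, sub_self]
  obtain ⟨a, ha⟩ := exists_tendsto_act_mul hzy (e := 1 - F * E) fun v => hS _ (by
    rw [Matrix.mulVec_mulVec, hEe, Matrix.zero_mulVec])
  obtain ⟨b, hb⟩ := exists_tendsto_mul_act hzy (e := 1 - F * E) fun v hv => by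
    rw [Matrix.sub_mulVec, ← Matrix.mulVec_mulVec, hT v hv, Matrix.one_mulVec, sub_self]
  have hee : (1 - F * E) * (1 - F * E) = 1 - F * E := by
    rw [sub_mul, one_mul, Matrix.mul_assoc, hEe, Matrix.mul_zero, sub_zero]
  have hp : PartialIntertwiner x y (1 - F * E) a b :=
    (isClosed_partialIntertwiner x (1 - F * E)).mem_of_tendsto
      (hzy.prodMk_nhds (ha.prodMk_nhds hb)) (Eventually.of_forall fun k =>
        partialIntertwiner_act hee
          (fun k l => by rw [mul_sub, sub_mul, mul_one, one_mul, h.comm])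
          (fun l => by rw [Matrix.sub_mul, Matrix.mul_assoc, h.mul_i, Matrix.one_mul,
            Matrix.mul_zero, sub_zero])
          (fun l => by rw [Matrix.mul_sub, ← Matrix.mul_assoc, h.j_mul, Matrix.mul_one,
            Matrix.zero_mul, sub_zero]) (g k))
  have hab : Tendsto (fun k => (g k : Matrix (Fin n) (Fin n) ℂ) * (1 - F * E) *
      (((g k)⁻¹ : (Matrix (Fin n) (Fin n) ℂ)ˣ) : Matrix (Fin n) (Fin n) ℂ)) atTop
      (𝓝 (a * b)) := by
    refine (ha.mul hb).congr fun k => ?_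
    rw [← mul_assoc, mul_assoc (g k : Matrix (Fin n) (Fin n) ℂ), hee]
  have hidem : IsIdempotentElem (1 - a * b) := by
    refine IsIdempotentElem.one_sub ?_
    rw [IsIdempotentElem, mul_assoc, ← mul_assoc b, hp.b_mul_a, hp.e_mul_b]
  have htr : (1 - a * b).trace = p := by
    rw [Matrix.trace_sub, Matrix.trace_mul_comm a, hp.b_mul_a, Matrix.trace_sub, sub_sub_cancel,
      Matrix.trace_mul_comm, h.mul_eq_one, Matrix.trace_one, Fintype.card_fin]
  obtain ⟨E', F', hEF, hFE⟩ := exists_matrix_splitting_of_trace hidem htr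
  exact h.mem_orbit_of_partialIntertwiner hp hEF hFE (h.block_mem_conjClass hcl hzy hab hEF hFE)

end MatrixSplitting

lemma isClosed_orbit_of_goodDecomp {x : ADHMSpace n m} {V₁ V₂ : Submodule ℂ (Fin n → ℂ)}
    (h : ADHMGoodDecomp x V₁ V₂) : IsClosed (orbit x) := by
  obtain ⟨rfl, rfl⟩ := goodDecomp_eq_cores h
  obtain ⟨hc, h₁, h₂, hi, hj, -, -, p, φ, M, hM, hcl⟩ := h
  obtain ⟨E, F, hEF, hF, hS, hT⟩ := IsSplitting.exists_matrixSplitting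
    ⟨hc, (bInvariant_iff x _).1 h₁, (bInvariant_iff x _).1 h₂, (containsImages_iff x _).1 hi,
      (inKernels_iff x _).1 hj⟩ φ
  refine hEF.isClosed_orbit (fun v => (hS v).2) hT ?_
  obtain rfl : M = fun k l => E * x.1 k l * F := funext fun k => funext fun l => by
    have : F * M k l = x.1 k l * F := matrix_ext_mulVec fun w => by
      rw [← Matrix.mulVec_mulVec, ← Matrix.mulVec_mulVec, hF, hF, hM]
    rw [Matrix.mul_assoc, ← this, ← Matrix.mul_assoc, hEF.mul_eq_one, Matrix.one_mul]
  exact hcl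

end ADHM

/-- the orbit `GL(V)·x` of an ADHM datum for `ℙ¹` over `ℂ` is closed if and
only if `x` splits as `x₁ ⊕ x₂` along a decomposition `V = V₁ ⊕ V₂` with `x₁` stable and
costable on `(W, V₁)` and `x₂ = (B|_{V₂},0,0)` with closed `GL(V₂)`-orbit; moreover such a
decomposition is unique. -/
theorem closed_orbit_iff_good_decomposition {n m : ℕ}
    (x : ADHMSpace n m) (hx : ADHMEq x) :
    (IsClosed {y : ADHMSpace n m | ∃ g : (Matrix (Fin n) (Fin n) ℂ)ˣ, y = ADHMAct g x} ↔
      ∃ V₁ V₂ : Submodule ℂ (Fin n → ℂ), ADHMGoodDecomp x V₁ V₂) ∧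
    (∀ V₁ V₂ V₁' V₂' : Submodule ℂ (Fin n → ℂ),
      ADHMGoodDecomp x V₁ V₂ → ADHMGoodDecomp x V₁' V₂' → V₁ = V₁' ∧ V₂ = V₂') :=
  ⟨⟨fun h => ⟨_, _, ADHM.exists_goodDecomp h⟩,
    fun ⟨_, _, h⟩ => ADHM.isClosed_orbit_of_goodDecomp h⟩,
    fun _ _ _ _ h h' => ⟨(ADHM.goodDecomp_eq_cores h).1.trans (ADHM.goodDecomp_eq_cores h').1.symm,
      (ADHM.goodDecomp_eq_cores h).2.trans (ADHM.goodDecomp_eq_cores h').2.symm⟩⟩
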